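/- Let n ≥ 3 and let e₁ denote the first standard basis vector of ℝⁿ. There do not exist: a nonempty connected open set Ω ⊆ ℝⁿ, a smooth map F : Ω → ℝⁿ with F(x) ≠ 0 for all x ∈ Ω and whose derivative DF(x) is a conformal linear map (a nonzero scalar multiple of a linear isometry) at every x ∈ Ω, and real numbers a ≠ 0 and b, such that e₁·x = a·log|F(x)| + b for all x ∈ Ω. In other words, the limiting Carleman weights e₁·x and log|x| lie in different orbits under the action of the conformal group combined with affine reparametrization φ ↦ aφ + b. -/

import Mathlib

open scoped RealInnerProductSpace

noncomputable section

section aux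

variable {E : Type*} [NormedAddCommGroup E] [InnerProductSpace ℝ E]

/-- directional derivative -/
def dirD {G : Type*} [NormedAddCommGroup G] [NormedSpace ℝ G] (v : E) (f : E → G) : E → G :=
  fun x => fderiv ℝ f x v

lemma dirD_smooth {Ω : Set E} (hΩ : IsOpen Ω) {f : E → E}
    (hf : ContDiffOn ℝ (⊤ : ℕ∞) f Ω) (v : E) : ContDiffOn ℝ (⊤ : ℕ∞) (dirD v f) Ω := by
  have h : ContDiffOn ℝ (⊤ : ℕ∞) (fderiv ℝ f) Ω :=
    hf.fderiv_of_isOpen hΩ (by simp)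
  exact h.clm_apply contDiffOn_const

lemma smooth_diff {Ω : Set E} (hΩ : IsOpen Ω) {f : E → E}
    (hf : ContDiffOn ℝ (⊤ : ℕ∞) f Ω) {x : E} (hx : x ∈ Ω) : DifferentiableAt ℝ f x :=
  (hf.contDiffAt (hΩ.mem_nhds hx)).differentiableAt (by simp)

lemma dirD_symm {Ω : Set E} (hΩ : IsOpen Ω) {f : E → E}
    (hf : ContDiffOn ℝ (⊤ : ℕ∞) f Ω) (v w : E) {x : E} (hx : x ∈ Ω) :
    dirD v (dirD w f) x = dirD w (dirD v f) x := by
  have hc := hf.contDiffAt (hΩ.mem_nhds hx)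
  have hs : IsSymmSndFDerivAt ℝ f x := by
    apply hc.isSymmSndFDerivAt
    simp only [minSmoothness_of_isRCLikeNormedField]
    exact WithTop.coe_le_coe.2 (le_top : (2 : ℕ∞) ≤ ⊤)
  have h : ContDiffOn ℝ (⊤ : ℕ∞) (fderiv ℝ f) Ω :=
    hf.fderiv_of_isOpen hΩ (by simp)
  have hd : DifferentiableAt ℝ (fderiv ℝ f) x :=
    (h.contDiffAt (hΩ.mem_nhds hx)).differentiableAt (by simp)
  have key : ∀ p q : E, dirD p (dirD q f) x = fderiv ℝ (fderiv ℝ f) x p q := by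
    intro p q
    unfold dirD
    rw [fderiv_clm_apply hd (differentiableAt_const q)]
    simp
  rw [key, key]
  exact hs v w

lemma dirD_congr {G : Type*} [NormedAddCommGroup G] [NormedSpace ℝ G]
    {Ω : Set E} (hΩ : IsOpen Ω) {f g : E → G} (h : ∀ x ∈ Ω, f x = g x) (v : E)
    {x : E} (hx : x ∈ Ω) : dirD v f x = dirD v g x := by
  have : f =ᶠ[nhds x] g := Filter.eventually_of_mem (hΩ.mem_nhds hx) h
  unfold dirD
  rw [this.fderiv_eq]

lemma dirD_inner {Ω : Set E} (hΩ : IsOpen Ω) {f g : E → E}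
    (hf : ContDiffOn ℝ (⊤ : ℕ∞) f Ω) (hg : ContDiffOn ℝ (⊤ : ℕ∞) g Ω) (v : E)
    {x : E} (hx : x ∈ Ω) :
    dirD v (fun y => ⟪f y, g y⟫) x = ⟪f x, dirD v g x⟫ + ⟪dirD v f x, g x⟫ := by
  unfold dirD
  rw [fderiv_inner_apply ℝ (smooth_diff hΩ hf hx) (smooth_diff hΩ hg hx)]

lemma dirD_smul {Ω : Set E} (hΩ : IsOpen Ω) {f : E → E}
    (hf : ContDiffOn ℝ (⊤ : ℕ∞) f Ω) (c : ℝ) (v : E) {x : E} (hx : x ∈ Ω) :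
    dirD v (fun y => c • f y) x = c • dirD v f x := by
  unfold dirD
  rw [fderiv_fun_const_smul (smooth_diff hΩ hf hx)]
  rfl

lemma dirD_add {Ω : Set E} (hΩ : IsOpen Ω) {f g : E → E}
    (hf : ContDiffOn ℝ (⊤ : ℕ∞) f Ω) (hg : ContDiffOn ℝ (⊤ : ℕ∞) g Ω) (v : E)
    {x : E} (hx : x ∈ Ω) :
    dirD v (fun y => f y + g y) x = dirD v f x + dirD v g x := by
  unfold dirD
  rw [fderiv_fun_add (smooth_diff hΩ hf hx) (smooth_diff hΩ hg hx)]
  rfl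

lemma dirD_add_dir (f : E → E) (u v : E) :
    dirD (u + v) f = fun x => dirD u f x + dirD v f x := by
  funext x; simp [dirD]

theorem core [FiniteDimensional ℝ E] {Ω : Set E} (hΩ : IsOpen Ω) (hne : Ω.Nonempty)
    {F : E → E} {a b : ℝ} (hF : ContDiffOn ℝ (⊤ : ℕ∞) F Ω) (h0 : ∀ x ∈ Ω, F x ≠ 0)
    (hconf : ∀ x ∈ Ω, IsConformalMap (fderiv ℝ F x)) (ha : a ≠ 0) (e u v : E)
    (he : ⟪e, e⟫ = (1 : ℝ)) (heu : ⟪e, u⟫ = (0 : ℝ)) (hev : ⟪e, v⟫ = (0 : ℝ))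
    (huv : ⟪u, v⟫ = (0 : ℝ)) (huu : ⟪u, u⟫ = (1 : ℝ)) (hvv : ⟪v, v⟫ = (1 : ℝ))
    (heq : ∀ x ∈ Ω, ⟪e, x⟫ = a * Real.log ‖F x‖ + b) : False := by
  have hpos : ∀ x ∈ Ω, 0 < ⟪F x, F x⟫ := fun x hx => real_inner_self_pos.2 (h0 x hx)
  have hsurj : ∀ x ∈ Ω, ∀ y, ∃ w, dirD w F x = y := by
    intro x hx y
    have hi : Function.Injective (fderiv ℝ F x).toLinearMap := (hconf x hx).injective
    exact LinearMap.surjective_of_injective hi y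
  -- derivative of N
  have hN : ∀ x ∈ Ω, ∀ w, ⟪F x, dirD w F x⟫ = ⟪e, w⟫ * ⟪F x, F x⟫ / a := by
    intro x hx w
    have h1 : ∀ y ∈ Ω, ⟪F y, F y⟫ = Real.exp (2 / a * (⟪e, y⟫ - b)) := by
      intro y hy
      have hn : 0 < ‖F y‖ := norm_pos_iff.2 (h0 y hy)
      have : 2 / a * (⟪e, y⟫ - b) = Real.log ‖F y‖ + Real.log ‖F y‖ := by
        rw [heq y hy]; field_simp; ring
      rw [this, Real.exp_add, Real.exp_log hn, real_inner_self_eq_norm_mul_norm]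
    have h2 := dirD_congr hΩ h1 w hx
    rw [dirD_inner hΩ hF hF w hx] at h2
    have h3 : HasFDerivAt (fun y : E => Real.exp (2 / a * (⟪e, y⟫ - b)))
        (Real.exp (2 / a * (⟪e, x⟫ - b)) • ((2 / a) • (innerSL ℝ e))) x := by
      have : HasFDerivAt (fun y : E => ⟪e, y⟫) (innerSL ℝ e) x := (innerSL ℝ e).hasFDerivAt
      exact ((this.sub_const b).const_mul (2 / a)).exp
    have h4 : dirD w (fun y : E => Real.exp (2 / a * (⟪e, y⟫ - b))) x
        = ⟪F x, F x⟫ * (2 / a * ⟪e, w⟫) := by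
      unfold dirD
      rw [h3.fderiv, h1 x hx]
      simp
    rw [h4, real_inner_comm (F x) (dirD w F x)] at h2
    have h5 : ⟪F x, dirD w F x⟫ = ⟪F x, F x⟫ * (1 / a * ⟪e, w⟫) := by
      have : ⟪F x, F x⟫ * (2 / a * ⟪e, w⟫) = 2 * (⟪F x, F x⟫ * (1 / a * ⟪e, w⟫)) := by ring
      linarith
    rw [h5]; ring
  -- metric
  have hmet : ∀ x ∈ Ω, F x = a • dirD e F x ∧
      ∀ p q, ⟪dirD p F x, dirD q F x⟫ = (1 / a ^ 2) * ⟪p, q⟫ * ⟪F x, F x⟫ := by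
    intro x hx
    obtain ⟨c, hc, li, hli⟩ := hconf x hx
    have hg : ∀ p q, ⟪dirD p F x, dirD q F x⟫ = c ^ 2 * ⟪p, q⟫ := by
      intro p q
      unfold dirD
      rw [hli]
      simp [inner_smul_left, inner_smul_right]
      ring
    obtain ⟨w, hw⟩ := hsurj x hx (F x)
    have hP := hpos x hx
    have h1 : ∀ q, c ^ 2 * ⟪w, q⟫ = ⟪e, q⟫ * ⟪F x, F x⟫ / a := by
      intro q
      rw [← hg, hw, hN x hx]
    have h2 : c ^ 2 • w = (⟪F x, F x⟫ / a) • e := by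
      apply ext_inner_right ℝ
      intro q
      rw [real_inner_smul_left, real_inner_smul_left, h1]; ring
    have h3 : ⟪F x, F x⟫ = c ^ 2 * ⟪w, w⟫ := by rw [← hg, hw]
    have hew : c ^ 2 * ⟪e, w⟫ = ⟪F x, F x⟫ / a := by
      rw [real_inner_comm, h1, he]; ring
    have hc2 : ⟪F x, F x⟫ = a ^ 2 * c ^ 2 := by
      have h4 := h1 w
      rw [← h3] at h4
      have h5 : ⟪e, w⟫ = a := by
        field_simp at h4
        nlinarith
      rw [h5] at hew
      field_simp at hew
      linarith
    have hwe : w = a • e := by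
      have : c ^ 2 • w = c ^ 2 • (a • e) := by
        rw [h2, hc2, smul_smul]; congr 1; field_simp
      exact smul_right_injective E (pow_ne_zero 2 hc) this
    refine ⟨?_, ?_⟩
    · rw [← hw, hwe]; simp [dirD]
    · intro p q
      rw [hg, hc2]; field_simp
  -- second derivative
  have hS := fun w => dirD_smooth hΩ hF w
  have hDm : ∀ x ∈ Ω, ∀ p q w,
      ⟪dirD p F x, dirD w (dirD q F) x⟫ + ⟪dirD w (dirD p F) x, dirD q F x⟫
        = (1 / a ^ 2) * ⟪p, q⟫ * (2 * (⟪e, w⟫ * ⟪F x, F x⟫ / a)) := by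
    intro x hx p q w
    rw [← dirD_inner hΩ (hS p) (hS q) w hx]
    have h1 : ∀ y ∈ Ω, ⟪dirD p F y, dirD q F y⟫ = ⟪((1 / a ^ 2) * ⟪p, q⟫) • F y, F y⟫ := by
      intro y hy
      rw [(hmet y hy).2, real_inner_smul_left]
    rw [dirD_congr hΩ h1 w hx,
      dirD_inner (f := fun y => ((1 / a ^ 2) * ⟪p, q⟫) • F y) hΩ (contDiffOn_const.smul hF) hF w hx,
      dirD_smul hΩ hF _ w hx,
      real_inner_smul_left, real_inner_smul_left, real_inner_comm (F x) (dirD w F x), hN x hx]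
    ring
  have hqq : ∀ x ∈ Ω, ∀ p, ⟪e, p⟫ = (0 : ℝ) →
      dirD p (dirD p F) x = (-(⟪p, p⟫ / a ^ 2)) • F x := by
    intro x hx p hp
    apply ext_inner_right ℝ
    intro y
    obtain ⟨w, rfl⟩ := hsurj x hx y
    have h1 := hDm x hx p w p
    have h2 := hDm x hx p p w
    rw [dirD_symm hΩ hF p w hx, hp] at h1
    rw [real_inner_comm (dirD p F x) (dirD w (dirD p F) x)] at h2
    rw [real_inner_smul_left, hN x hx]
    have h3 : (1 / a ^ 2) * ⟪p, p⟫ * (2 * (⟪e, w⟫ * ⟪F x, F x⟫ / a))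
      = 2 * (⟪p, p⟫ / a ^ 2 * (⟪e, w⟫ * ⟪F x, F x⟫ / a)) := by ring
    rw [h3] at h2
    simp only [zero_mul, zero_div, mul_zero] at h1
    linarith
  have hzero : ∀ x ∈ Ω, dirD u (dirD v F) x = (0 : ℝ) • F x := by
    intro x hx
    have h1 := hqq x hx (u + v) (by rw [inner_add_right, heu, hev, add_zero])
    rw [dirD_add_dir F u v, dirD_add hΩ (hS u) (hS v) _ hx, dirD_add_dir, dirD_add_dir] at h1
    simp only [] at h1
    rw [hqq x hx u heu, hqq x hx v hev, dirD_symm hΩ hF v u hx, inner_add_left, inner_add_right,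
      inner_add_right, real_inner_comm u v, huv, huu, hvv] at h1
    have h2 : (2 : ℝ) • dirD u (dirD v F) x = 0 := by
      have h3 : (2 : ℝ) • dirD u (dirD v F) x =
        ((-(1 / a ^ 2)) • F x + dirD u (dirD v F) x
          + (dirD u (dirD v F) x + (-(1 / a ^ 2)) • F x)) - (-((1 + 0 + (0 + 1)) / a ^ 2)) • F x := by
        module
      rw [h3, sub_eq_zero]
      first
        | exact h1
        | (rw [← h1]; abel)
    rw [zero_smul]
    exact (smul_eq_zero.1 h2).resolve_left two_ne_zero
  obtain ⟨x, hx⟩ := hne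
  have h1 : dirD u (dirD v (dirD u F)) x = 0 := by
    rw [dirD_congr hΩ (fun y hy => (dirD_symm hΩ hF v u hy).trans (hzero y hy)) u hx,
      dirD_smul hΩ hF _ _ hx, zero_smul]
  rw [dirD_symm hΩ (hS u) u v hx, dirD_congr hΩ (fun y hy => hqq y hy u heu) v hx,
    dirD_smul hΩ hF _ _ hx, huu] at h1
  have h2 := (smul_eq_zero.1 h1).resolve_left (by
    exact neg_ne_zero.2 (by positivity))
  have h3 := (hmet x hx).2 v v
  rw [h2, hvv, inner_zero_left] at h3
  have := hpos x hx
  have : 0 < 1 / a ^ 2 * 1 * ⟪F x, F x⟫ := by positivity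
  linarith

end aux

/-- the limiting Carleman weights `e₁·x` and `log|x|` lie in different
orbits of the conformal group (combined with affine reparametrization `φ ↦ aφ + b`):
there is no conformal map `F` on a nonempty connected open set `Ω ⊆ ℝⁿ`, `n ≥ 3`,
with `e₁·x = a log|F(x)| + b` on `Ω`. -/
theorem stmt_18 {n : ℕ} (hn : 3 ≤ n) :
    ¬ ∃ (Ω : Set (EuclideanSpace ℝ (Fin n)))
        (F : EuclideanSpace ℝ (Fin n) → EuclideanSpace ℝ (Fin n)) (a b : ℝ),
      Ω.Nonempty ∧ IsOpen Ω ∧ IsConnected Ω ∧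
      ContDiffOn ℝ (⊤ : ℕ∞) F Ω ∧
      (∀ x ∈ Ω, F x ≠ 0) ∧
      (∀ x ∈ Ω, IsConformalMap (fderiv ℝ F x)) ∧
      a ≠ 0 ∧
      (∀ x ∈ Ω,
        ⟪EuclideanSpace.single (⟨0, by omega⟩ : Fin n) (1 : ℝ), x⟫
          = a * Real.log ‖F x‖ + b) := by
  rintro ⟨Ω, F, a, b, hne, hΩ, -, hF, h0, hconf, ha, heq⟩
  refine core hΩ hne hF h0 hconf ha _ (EuclideanSpace.single (⟨1, by omega⟩ : Fin n) (1 : ℝ))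
    (EuclideanSpace.single (⟨2, by omega⟩ : Fin n) (1 : ℝ)) ?_ ?_ ?_ ?_ ?_ ?_ heq
  all_goals simp [EuclideanSpace.inner_single_left]
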